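/- arXiv:2311.01457 — 2 statements merged into one kernel-verified Lean document; each statement's English description precedes it below -/
import Mathlib

section
/- If the scores satisfy 0 ≤ s_t ≤ B for all t and the initial quantile satisfies q_1 ≤ B + η·(1−α), then q_t ≤ B + η·(1−α) for every t ≥ 1. -/
/-- Error indicator: `1` if the score exceeds the current quantile, `0` otherwise. -/
noncomputable def errInd (s q : ℕ → ℝ) (t : ℕ) : ℝ := if q t < s t then 1 else 0

/-- If the scores satisfy `0 ≤ s_t ≤ B` and `q_1 ≤ B + η·(1−α)`, then the quantile
tracker iterates satisfy `q_t ≤ B + η·(1−α)` for every `t ≥ 1`. -/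
theorem quantile_tracker_upper_bound
    (α η B : ℝ) (hα0 : 0 < α) (hα1 : α < 1) (hη : 0 < η) (hB : 0 < B)
    (s q : ℕ → ℝ)
    (hs : ∀ t, 1 ≤ t → 0 ≤ s t ∧ s t ≤ B)
    (hrec : ∀ t, 1 ≤ t → q (t + 1) = q t + η * (errInd s q t - α))
    (hq1 : q 1 ≤ B + η * (1 - α)) :
    ∀ t, 1 ≤ t → q t ≤ B + η * (1 - α) := by
  intro t ht
  induction t, ht using Nat.le_induction with
  | base => exact hq1
  | succ t ht ih =>
    rw [hrec t ht, errInd]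
    split_ifs with h
    · linarith [(hs t ht).2]
    · nlinarith [mul_pos hη hα0]
end

section
/- If the scores satisfy 0 ≤ s_t ≤ B for all t and the initial quantile satisfies q_1 ≥ −η·α, then q_t ≥ −η·α for every t ≥ 1. -/
/-- If the scores satisfy `0 ≤ s_t ≤ B` and `q_1 ≥ −η·α`, then the quantile
tracker iterates satisfy `q_t ≥ −η·α` for every `t ≥ 1`. -/
theorem quantile_tracker_lower_bound
    (α η B : ℝ) (hα0 : 0 < α) (hα1 : α < 1) (hη : 0 < η) (hB : 0 < B)
    (s q : ℕ → ℝ)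
    (hs : ∀ t, 1 ≤ t → 0 ≤ s t ∧ s t ≤ B)
    (hrec : ∀ t, 1 ≤ t → q (t + 1) = q t + η * (errInd s q t - α))
    (hq1 : -(η * α) ≤ q 1) :
    ∀ t, 1 ≤ t → -(η * α) ≤ q t := by
  intro t ht
  induction t, ht using Nat.le_induction with
  | base => exact hq1
  | succ t ht ih =>
    rw [hrec t ht, errInd]
    split_ifs with h
    · nlinarith [mul_pos hη (sub_pos.mpr hα1)]
    · linarith [(hs t ht).1]
end
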